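/- A negative subcategory generates a weight structure on the subcategory it classically generates: if A is a Karoubian additive full subcategory of a triangulated category C with Hom(A, B[i]) = 0 for all A, B ∈ Obj A and i > 0, then on the thick triangulated subcategory ⟨Obj A⟩ generated by A there is a unique weight structure w whose nonpositive part is the envelope of ⋃_{i≤0} Obj A[i], whose nonnegative part is the envelope of ⋃_{i≥0} Obj A[i], and whose heart equals A. -/

import Mathlib

open CategoryTheory CategoryTheory.Limits CategoryTheory.Pretriangulated

universe v u u'

variable (C : Type u) [Category.{v} C] [HasZeroObject C] [HasShift C ℤ]
  [Preadditive C] [∀ n : ℤ, (shiftFunctor C n).Additive] [Pretriangulated C]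

/-- A weight structure on a triangulated category `C`:
a pair of Karoubi-closed classes `le = C_{w≤0}` and `ge = C_{w≥0}` satisfying
semi-invariance with respect to translations, orthogonality and the existence of
weight decompositions. -/
structure WeightStructure where
  /-- the class `C_{w≤0}` -/
  le : Set C
  /-- the class `C_{w≥0}` -/
  ge : Set C
  /-- `C_{w≤0}` is Karoubi-closed (contains all retracts of its elements) -/
  le_retract : ∀ ⦃M N : C⦄, N ∈ le → ∀ (i : M ⟶ N) (r : N ⟶ M), i ≫ r = 𝟙 M → M ∈ le
  /-- `C_{w≥0}` is Karoubi-closed -/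
  ge_retract : ∀ ⦃M N : C⦄, N ∈ ge → ∀ (i : M ⟶ N) (r : N ⟶ M), i ≫ r = 𝟙 M → M ∈ ge
  /-- `C_{w≤0} ⊆ C_{w≤0}[1]`, i.e. `M ∈ C_{w≤0} → M[-1] ∈ C_{w≤0}` -/
  le_shift : ∀ ⦃M : C⦄, M ∈ le → M⟦(-1 : ℤ)⟧ ∈ le
  /-- `C_{w≥0}[1] ⊆ C_{w≥0}` -/
  ge_shift : ∀ ⦃M : C⦄, M ∈ ge → M⟦(1 : ℤ)⟧ ∈ ge
  /-- orthogonality: `C_{w≤0} ⊥ C_{w≥0}[1]` -/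
  orth : ∀ ⦃M N : C⦄, M ∈ le → N ∈ ge → ∀ f : M ⟶ N⟦(1 : ℤ)⟧, f = 0
  /-- weight decompositions -/
  decomp : ∀ M : C, ∃ (L R : C) (f : L ⟶ M) (g : M ⟶ R) (h : R ⟶ L⟦(1 : ℤ)⟧),
    Triangle.mk f g h ∈ (distTriang C) ∧ L ∈ le ∧ R⟦(-1 : ℤ)⟧ ∈ ge

/-- A class of objects is retract-closed (Karoubi-closed) in `C`. -/
def RetractClosed (T : Set C) : Prop :=
  ∀ ⦃X Y : C⦄, Y ∈ T → ∀ (i : X ⟶ Y) (r : Y ⟶ X), i ≫ r = 𝟙 X → X ∈ T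

/-- A class of objects is extension-closed: it contains the zero objects and the
middle term of any distinguished triangle whose outer terms lie in it. -/
def ExtClosed (T : Set C) : Prop :=
  (∀ Z : C, IsZero Z → Z ∈ T) ∧
  (∀ Tr : Triangle C, Tr ∈ (distTriang C) → Tr.obj₁ ∈ T → Tr.obj₃ ∈ T → Tr.obj₂ ∈ T)

/-- The envelope of a class `S`: the smallest extension-closed Karoubi-closed class
containing `S` (and `0`). -/
def envelope (S : Set C) : Set C :=
  {X | ∀ T : Set C, S ⊆ T → RetractClosed C T → ExtClosed C T → X ∈ T}

/-- A class is a thick triangulated subcategory (strictly full, triangulated,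
Karoubi-closed). -/
def IsThickClass (T : Set C) : Prop :=
  RetractClosed C T ∧ (∀ Z : C, IsZero Z → Z ∈ T) ∧
  (∀ (n : ℤ) ⦃X : C⦄, X ∈ T → X⟦n⟧ ∈ T) ∧
  (∀ Tr : Triangle C, Tr ∈ (distTriang C) → Tr.obj₁ ∈ T → Tr.obj₂ ∈ T → Tr.obj₃ ∈ T)

/-- The thick (Karoubi-closed) triangulated subcategory `⟨S⟩` generated by `S`. -/
def thickClosure (S : Set C) : Set C :=
  {X | ∀ T : Set C, IsThickClass C T → S ⊆ T → X ∈ T}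

/-- A weight structure on the full triangulated subcategory of `C` with object class
`T`, given by classes `le`, `ge` of objects of `T`. -/
def IsWeightStructureOn (T le ge : Set C) : Prop :=
  le ⊆ T ∧ ge ⊆ T ∧
  (∀ ⦃X Y : C⦄, X ∈ T → Y ∈ le → ∀ (i : X ⟶ Y) (r : Y ⟶ X), i ≫ r = 𝟙 X → X ∈ le) ∧
  (∀ ⦃X Y : C⦄, X ∈ T → Y ∈ ge → ∀ (i : X ⟶ Y) (r : Y ⟶ X), i ≫ r = 𝟙 X → X ∈ ge) ∧
  (∀ ⦃X : C⦄, X ∈ le → X⟦(-1 : ℤ)⟧ ∈ le) ∧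
  (∀ ⦃X : C⦄, X ∈ ge → X⟦(1 : ℤ)⟧ ∈ ge) ∧
  (∀ ⦃X Y : C⦄, X ∈ le → Y ∈ ge → ∀ f : X ⟶ Y⟦(1 : ℤ)⟧, f = 0) ∧
  (∀ M ∈ T, ∃ (L R : C) (f : L ⟶ M) (g : M ⟶ R) (h : R ⟶ L⟦(1 : ℤ)⟧),
    Triangle.mk f g h ∈ (distTriang C) ∧ L ∈ le ∧ R⟦(-1 : ℤ)⟧ ∈ ge)

section Auxiliary

variable {C}

/-- All morphisms from `X` to `Y` vanish. -/
def HomZero (X Y : C) : Prop := ∀ f : X ⟶ Y, f = 0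

lemma HomZero.of_iso {X Y X' Y' : C} (h : HomZero X Y) (e : X' ≅ X) (e' : Y' ≅ Y) :
    HomZero X' Y' := fun f => by
  rw [← cancel_mono e'.hom, ← cancel_epi e.inv, h (e.inv ≫ f ≫ e'.hom)]
  simp

lemma HomZero.shift {X Y : C} (h : HomZero X Y) (n : ℤ) : HomZero (X⟦n⟧) (Y⟦n⟧) := fun f => by
  obtain ⟨g, rfl⟩ := (shiftFunctor C n).map_surjective f
  rw [h g, Functor.map_zero]

lemma HomZero.to_shift {X Y : C} {n : ℤ} (h : HomZero (X⟦-n⟧) Y) : HomZero X (Y⟦n⟧) :=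
  (h.shift n).of_iso (shiftNegShift X n).symm (Iso.refl _)

/-- Post-composition with `u` is surjective on morphisms from `B`. -/
def LiftsFrom (B : C) {X Y : C} (u : X ⟶ Y) : Prop := ∀ h : B ⟶ Y, ∃ k : B ⟶ X, k ≫ u = h

/-- Post-composition with `u` is injective on morphisms from `B`. -/
def CancelsFrom (B : C) {X Y : C} (u : X ⟶ Y) : Prop := ∀ g : B ⟶ X, g ≫ u = 0 → g = 0

lemma CancelsFrom.shift {B X Y : C} {u : X ⟶ Y} {n : ℤ} (h : CancelsFrom (B⟦-n⟧) u) :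
    CancelsFrom B (u⟦n⟧') := fun g hg => by
  obtain ⟨k, hk⟩ := (shiftFunctor C n).map_surjective ((shiftNegShift B n).hom ≫ g)
  have hku : k ≫ u = 0 := (shiftFunctor C n).map_injective (by
    rw [Functor.map_comp, hk, Category.assoc, hg, comp_zero, Functor.map_zero])
  rw [h k hku, Functor.map_zero] at hk
  rw [← cancel_epi (shiftNegShift B n).hom, ← hk, comp_zero]

section Triangles

variable {T : Triangle C}

lemma liftsFrom_mor₁ (hT : T ∈ distTriang C) {B : C} (h : HomZero B T.obj₃) :
    LiftsFrom B T.mor₁ := fun f => by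
  obtain ⟨k, hk⟩ := Triangle.coyoneda_exact₂ T hT f (h _)
  exact ⟨k, hk.symm⟩

lemma cancelsFrom_mor₁_shift (hT : T ∈ distTriang C) {B : C} (h : HomZero B T.obj₃) :
    CancelsFrom B (T.mor₁⟦(1 : ℤ)⟧') :=
  fun f hf => by
  obtain ⟨k, hk⟩ := Triangle.coyoneda_exact₁ T hT f hf
  rw [hk, h k, zero_comp]

lemma cancelsFrom_mor₁ (hT : T ∈ distTriang C) {B : C} (h : HomZero B (T.obj₃⟦(-1 : ℤ)⟧)) :
    CancelsFrom B T.mor₁ :=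
  fun f hf => by
  obtain ⟨k, hk⟩ := Triangle.coyoneda_exact₂ _ (inv_rot_of_distTriang _ hT) f hf
  obtain rfl : k = 0 := h k
  rwa [zero_comp] at hk

lemma liftsFrom_mor₁_shift (hT : T ∈ distTriang C) {B : C} (h : HomZero B (T.obj₃⟦(1 : ℤ)⟧)) :
    LiftsFrom B (T.mor₁⟦(1 : ℤ)⟧') := fun f => by
  obtain ⟨k, hk⟩ := Triangle.coyoneda_exact₂ _ (rot_of_distTriang _ (rot_of_distTriang _
    (rot_of_distTriang _ hT))) f (h _)
  exact ⟨-k, hk.trans ((Preadditive.comp_neg _ _).trans (Preadditive.neg_comp _ _).symm) |>.symm⟩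

lemma homZero_obj₃ (hT : T ∈ distTriang C) {B : C} (h₁ : LiftsFrom B T.mor₁)
    (h₂ : CancelsFrom B (T.mor₁⟦(1 : ℤ)⟧')) :
    HomZero B T.obj₃ := fun f => by
  have hf : f ≫ T.mor₃ = 0 := h₂ _ (by
    rw [Category.assoc, comp_distTriang_mor_zero₃₁ T hT, comp_zero])
  obtain ⟨g, rfl⟩ := Triangle.coyoneda_exact₃ T hT f hf
  obtain ⟨k, rfl⟩ := h₁ g
  rw [Category.assoc, comp_distTriang_mor_zero₁₂ T hT, comp_zero]

lemma homZero_obj₂ (hT : T ∈ distTriang C) {B : C} (h₁ : HomZero B T.obj₁) (h₃ : HomZero B T.obj₃) :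
    HomZero B T.obj₂ := fun f => by
  obtain ⟨g, rfl⟩ := Triangle.coyoneda_exact₂ T hT f (h₃ _)
  rw [h₁ g, zero_comp]

lemma obj₂_homZero (hT : T ∈ distTriang C) {N : C} (h₁ : HomZero T.obj₁ N) (h₃ : HomZero T.obj₃ N) :
    HomZero T.obj₂ N := fun f => by
  obtain ⟨g, rfl⟩ := Triangle.yoneda_exact₂ T hT f (h₁ _)
  rw [h₃ g, comp_zero]

/-- The first morphism of a distinguished triangle is a split monomorphism if the second one
is a split epimorphism. -/
lemma exists_retraction (hT : T ∈ distTriang C) {i : T.obj₃ ⟶ T.obj₂} (hi : i ≫ T.mor₂ = 𝟙 _) :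
    ∃ t : T.obj₂ ⟶ T.obj₁, T.mor₁ ≫ t = 𝟙 _ := by
  have h₃ : T.mor₃ = 0 := by
    rw [← Category.id_comp T.mor₃, ← hi, Category.assoc, comp_distTriang_mor_zero₂₃ T hT, comp_zero]
  have := Triangle.mono₁ T hT h₃
  obtain ⟨t, ht⟩ := Triangle.coyoneda_exact₂ T hT (𝟙 _ - T.mor₂ ≫ i) (by
    rw [Preadditive.sub_comp, Category.assoc, hi, Category.id_comp, Category.comp_id, sub_self])
  refine ⟨t, ?_⟩
  rw [← cancel_mono T.mor₁, Category.assoc, ← ht, Preadditive.comp_sub, ← Category.assoc,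
    comp_distTriang_mor_zero₁₂ T hT]
  simp

end Triangles

section FourLemmas

variable {T T' : Triangle C} {B : C}

lemma liftsFrom_hom₃ (hT : T ∈ distTriang C) (hT' : T' ∈ distTriang C) (φ : T ⟶ T')
    (h₁ : LiftsFrom B (φ.hom₁⟦(1 : ℤ)⟧')) (h₂ : LiftsFrom B φ.hom₂)
    (h₂' : CancelsFrom B (φ.hom₂⟦(1 : ℤ)⟧')) : LiftsFrom B φ.hom₃ := fun h => by
  obtain ⟨k, hk⟩ := h₁ (h ≫ T'.mor₃)
  obtain ⟨m, rfl⟩ := Triangle.coyoneda_exact₁ T hT k (h₂' _ (by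
    rw [Category.assoc, ← Functor.map_comp, φ.comm₁, Functor.map_comp, reassoc_of% hk,
      comp_distTriang_mor_zero₃₁ T' hT', comp_zero]))
  obtain ⟨p, hp⟩ := Triangle.coyoneda_exact₃ T' hT' (h - m ≫ φ.hom₃) (by
    rw [Preadditive.sub_comp, ← hk, Category.assoc, Category.assoc, φ.comm₃, sub_self])
  obtain ⟨q, rfl⟩ := h₂ p
  refine ⟨m + q ≫ T.mor₂, ?_⟩
  rw [Preadditive.add_comp, Category.assoc, φ.comm₂, ← Category.assoc, ← hp, add_sub_cancel]

lemma cancelsFrom_hom₃ (hT : T ∈ distTriang C) (hT' : T' ∈ distTriang C) (φ : T ⟶ T')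
    (h₁ : LiftsFrom B φ.hom₁) (h₁' : CancelsFrom B (φ.hom₁⟦(1 : ℤ)⟧'))
    (h₂ : CancelsFrom B φ.hom₂) : CancelsFrom B φ.hom₃ := fun g hg => by
  obtain ⟨m, rfl⟩ := Triangle.coyoneda_exact₃ T hT g (h₁' _ (by
    rw [Category.assoc, φ.comm₃, reassoc_of% hg, zero_comp]))
  obtain ⟨p, hp⟩ := Triangle.coyoneda_exact₂ T' hT' (m ≫ φ.hom₂) (by
    rw [Category.assoc, ← φ.comm₂, ← Category.assoc, hg])
  obtain ⟨q, rfl⟩ := h₁ p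
  have hm : m - q ≫ T.mor₁ = 0 := h₂ _ (by
    rw [Preadditive.sub_comp, hp, Category.assoc, Category.assoc, φ.comm₁, sub_self])
  rw [sub_eq_zero.1 hm, Category.assoc, comp_distTriang_mor_zero₁₂ T hT, comp_zero]

end FourLemmas

section Classes

lemma RetractClosed.of_iso {T : Set C} (hT : RetractClosed C T) {X Y : C} (hY : Y ∈ T)
    (e : X ≅ Y) : X ∈ T :=
  hT hY e.hom e.inv e.hom_inv_id

lemma subset_envelope (S : Set C) : S ⊆ envelope C S := fun _ hX _ hS _ _ => hS hX

lemma retractClosed_envelope (S : Set C) : RetractClosed C (envelope C S) :=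
  fun _ _ hY i r hir T hS hr he => hr (hY T hS hr he) i r hir

lemma extClosed_envelope (S : Set C) : ExtClosed C (envelope C S) :=
  ⟨fun Z hZ _ _ _ he => he.1 Z hZ,
    fun Tr hTr h₁ h₃ T hS hr he => he.2 Tr hTr (h₁ T hS hr he) (h₃ T hS hr he)⟩

lemma homZero_of_mem_envelope_left {S : Set C} {N : C} (h : ∀ B ∈ S, HomZero B N) {B : C}
    (hB : B ∈ envelope C S) : HomZero B N := by
  refine hB {B | HomZero B N} h ?_ ⟨fun Z hZ f => hZ.eq_of_src _ _, ?_⟩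
  · intro X Y hY i r hir f
    rw [← Category.id_comp f, ← hir, Category.assoc, hY (r ≫ f), comp_zero]
  · intro Tr hTr h₁ h₃
    exact obj₂_homZero hTr h₁ h₃

lemma retractClosed_homZero (B : C) : RetractClosed C {N | HomZero B N} := by
  intro X Y hY i r hir f
  rw [← Category.comp_id f, ← hir, ← Category.assoc, hY (f ≫ i), zero_comp]

lemma homZero_of_mem_envelope_right {S : Set C} {B : C} (h : ∀ N ∈ S, HomZero B N) {N : C}
    (hN : N ∈ envelope C S) : HomZero B N :=
  hN {N | HomZero B N} h (retractClosed_homZero B)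
    ⟨fun _ hZ _ => hZ.eq_of_tgt _ _, fun _ hTr h₁ h₃ => homZero_obj₂ hTr h₁ h₃⟩

lemma subset_thickClosure (S : Set C) : S ⊆ thickClosure C S := fun _ hX _ _ hS => hS hX

lemma isThickClass_thickClosure (S : Set C) : IsThickClass C (thickClosure C S) :=
  ⟨fun _ _ hY i r hir T hT hS => hT.1 (hY T hT hS) i r hir,
    fun Z hZ _ hT _ => hT.2.1 Z hZ,
    fun n _ hX T hT hS => hT.2.2.1 n (hX T hT hS),
    fun Tr hTr h₁ h₂ T hT hS => hT.2.2.2 Tr hTr (h₁ T hT hS) (h₂ T hT hS)⟩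

lemma IsThickClass.extClosed {T : Set C} (hT : IsThickClass C T) : ExtClosed C T :=
  ⟨hT.2.1, fun Tr hTr h₁ h₃ =>
    hT.2.2.2 Tr.invRotate (inv_rot_of_distTriang _ hTr) (hT.2.2.1 (-1) h₃) h₁⟩

end Classes

/-- The envelope of the shifts `X⟦i⟧` of objects `X ∈ A` with `i ∈ I`. -/
def shiftEnvelope (A : Set C) (I : Set ℤ) : Set C :=
  envelope C {Y : C | ∃ X ∈ A, ∃ i : ℤ, i ∈ I ∧ Y = X⟦i⟧}

section ShiftEnvelope

variable {A : Set C} {I J : Set ℤ}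

lemma shift_mem_shiftEnvelope {X : C} (hX : X ∈ A) {i : ℤ} (hi : i ∈ I) :
    X⟦i⟧ ∈ shiftEnvelope A I :=
  subset_envelope _ ⟨X, hX, i, hi, rfl⟩

lemma subset_shiftEnvelope (h : (0 : ℤ) ∈ I) : A ⊆ shiftEnvelope A I := fun X hX =>
  (retractClosed_envelope _).of_iso (shift_mem_shiftEnvelope hX h) (shiftZero ℤ X).symm

lemma shift_shiftEnvelope {n : ℤ} (h : ∀ i ∈ I, i + n ∈ J) {X : C}
    (hX : X ∈ shiftEnvelope A I) : X⟦n⟧ ∈ shiftEnvelope A J := by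
  refine hX {X | X⟦n⟧ ∈ shiftEnvelope A J} ?_ ?_ ⟨?_, ?_⟩
  · rintro _ ⟨X, hX, i, hi, rfl⟩
    exact (retractClosed_envelope _).of_iso (shift_mem_shiftEnvelope hX (h i hi))
      (shiftAdd X i n).symm
  · intro X Y hY i r hir
    exact retractClosed_envelope _ hY (i⟦n⟧') (r⟦n⟧')
      (by rw [← Functor.map_comp, hir, CategoryTheory.Functor.map_id])
  · intro Z hZ
    exact (extClosed_envelope _).1 _ (Functor.map_isZero _ hZ)
  · intro Tr hTr h₁ h₃
    exact (extClosed_envelope _).2 _ (Triangle.shift_distinguished _ hTr n) h₁ h₃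

lemma shiftEnvelope_mono (h : I ⊆ J) : shiftEnvelope A I ⊆ shiftEnvelope A J :=
  fun _ hX T hS => hX T fun _ ⟨X, hX, i, hi, hY⟩ => hS ⟨X, hX, i, h hi, hY⟩

lemma shiftEnvelope_subset_thickClosure : shiftEnvelope A I ⊆ thickClosure C A := fun X hX =>
  have hT := isThickClass_thickClosure A
  hX _ (by rintro _ ⟨X, hX, i, -, rfl⟩; exact hT.2.2.1 i (subset_thickClosure A hX))
    hT.1 hT.extClosed

end ShiftEnvelope

/-- Negativity: there are no nonzero morphisms from objects of `A` to their positive shifts. -/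
def IsNegative (A : Set C) : Prop :=
  ∀ ⦃X Y : C⦄, X ∈ A → Y ∈ A → ∀ i : ℤ, 0 < i → HomZero X (Y⟦i⟧)

/-- The objects `R` such that `Hom(B, R) = 0` for every `B` in the envelope of `A⟦i⟧`, `i ≤ n`. -/
def rightPerp (A : Set C) (n : ℤ) : Set C := {R | ∀ B ∈ shiftEnvelope A (Set.Iic n), HomZero B R}

/-- `M` is an extension of an object of `rightPerp A n` by one of `shiftEnvelope A (Set.Iic n)`. -/
def HasWeightDecomposition (A : Set C) (n : ℤ) (M : C) : Prop :=
  ∃ (L R : C) (f : L ⟶ M) (g : M ⟶ R) (h : R ⟶ L⟦(1 : ℤ)⟧),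
    Triangle.mk f g h ∈ (distTriang C) ∧ L ∈ shiftEnvelope A (Set.Iic n) ∧ R ∈ rightPerp A n

section RightPerp

variable {A : Set C}

lemma retractClosed_rightPerp (n : ℤ) : RetractClosed C (rightPerp A n) :=
  fun _ _ hY i r hir B hB => retractClosed_homZero B (hY B hB) i r hir

lemma extClosed_rightPerp (n : ℤ) : ExtClosed C (rightPerp A n) :=
  ⟨fun _ hZ _ _ _ => hZ.eq_of_tgt _ _, fun _ hTr h₁ h₃ B hB => homZero_obj₂ hTr (h₁ B hB) (h₃ B hB)⟩

lemma rightPerp_anti {m n : ℤ} (h : m ≤ n) : rightPerp A n ⊆ rightPerp A m :=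
  fun _ hR B hB => hR B (shiftEnvelope_mono (Set.Iic_subset_Iic.2 h) hB)

lemma shift_rightPerp {m n k : ℤ} (h : n + k = m) {R : C} (hR : R ∈ rightPerp A n) :
    R⟦k⟧ ∈ rightPerp A m := fun B hB =>
  HomZero.to_shift (hR _ (shift_shiftEnvelope (fun i hi => by
    simp only [Set.mem_Iic] at hi ⊢; lia) hB))

lemma homZero_shiftEnvelope (hA : IsNegative A) {I J : Set ℤ} (hIJ : ∀ i ∈ I, ∀ j ∈ J, i < j)
    {X Y : C} (hX : X ∈ shiftEnvelope A I) (hY : Y ∈ shiftEnvelope A J) : HomZero X Y := by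
  refine homZero_of_mem_envelope_left ?_ hX
  rintro _ ⟨X, hX, i, hi, rfl⟩
  refine homZero_of_mem_envelope_right ?_ hY
  rintro _ ⟨Y, hY, j, hj, rfl⟩
  have := hIJ i hi j hj
  exact ((hA hX hY (j - i) (by lia)).shift i).of_iso (Iso.refl _)
    ((shiftFunctorAdd' C (j - i) i j (by lia)).app Y)

lemma shiftEnvelope_Ici_subset_rightPerp (hA : IsNegative A) {m n : ℤ} (h : m < n) :
    shiftEnvelope A (Set.Ici n) ⊆ rightPerp A m := fun _ hY _ hB =>
  homZero_shiftEnvelope hA (fun i hi j hj => by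
    simp only [Set.mem_Iic, Set.mem_Ici] at hi hj; lia) hB hY

end RightPerp

namespace HasWeightDecomposition

variable {A : Set C} {n : ℤ}

lemma of_mem_shiftEnvelope {M : C} (hM : M ∈ shiftEnvelope A (Set.Iic n)) :
    HasWeightDecomposition A n M :=
  ⟨M, _, 𝟙 M, 0, 0, contractible_distinguished M, hM,
    (extClosed_rightPerp n).1 _ (isZero_zero C)⟩

lemma of_mem_rightPerp {M : C} (hM : M ∈ rightPerp A n) : HasWeightDecomposition A n M :=
  ⟨_, M, 0, 𝟙 M, 0, contractible_distinguished₁ M, (extClosed_envelope _).1 _ (isZero_zero C), hM⟩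

lemma shift {m k : ℤ} (hm : n + k = m) {M : C} (hM : HasWeightDecomposition A n M) :
    HasWeightDecomposition A m (M⟦k⟧) := by
  obtain ⟨L, R, f, g, h, hT, hL, hR⟩ := hM
  exact ⟨_, _, _, _, _, Triangle.shift_distinguished _ hT k,
    shift_shiftEnvelope (fun i hi => by simp only [Set.mem_Iic] at hi ⊢; lia) hL,
    shift_rightPerp hm hR⟩

/-- Weight decompositions of a cone. No octahedral axiom is needed, since the third vertex is
only required to be right orthogonal to a class of objects. -/
lemma obj₃ {T : Triangle C} (hT : T ∈ distTriang C) (h₁ : HasWeightDecomposition A (n - 1) T.obj₁)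
    (h₂ : HasWeightDecomposition A n T.obj₂) : HasWeightDecomposition A n T.obj₃ := by
  obtain ⟨L₁, R₁, l₁, q₁, d₁, hT₁, hL₁, hR₁⟩ := h₁
  obtain ⟨L₂, R₂, l₂, q₂, d₂, hT₂, hL₂, hR₂⟩ := h₂
  have hR₂' := rightPerp_anti (sub_one_lt n).le hR₂
  obtain ⟨a, ha⟩ := liftsFrom_mor₁ hT₂ (hR₂' _ hL₁) (l₁ ≫ T.mor₁)
  obtain ⟨L, b, d, hL⟩ := distinguished_cocone_triangle a
  obtain ⟨c, hc₂, hc₃⟩ := complete_distinguished_triangle_morphism _ _ hL hT l₁ l₂ ha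
  let φ : Triangle.mk a b d ⟶ T :=
    { hom₁ := l₁, hom₂ := l₂, hom₃ := c, comm₁ := ha, comm₂ := hc₂, comm₃ := hc₃ }
  obtain ⟨W, q, e, hW⟩ := distinguished_cocone_triangle c
  refine ⟨L, W, c, q, e, hW, ?_, fun B hB => homZero_obj₃ hW ?_ (CancelsFrom.shift ?_)⟩
  · exact (extClosed_envelope _).2 _ (rot_of_distTriang _ hL) hL₂
      (shift_shiftEnvelope (fun i hi => by simp only [Set.mem_Iic] at hi ⊢; lia) hL₁)
  · exact liftsFrom_hom₃ hL hT φ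
      (liftsFrom_mor₁_shift hT₁ (shift_rightPerp (by lia) hR₁ B hB))
      (liftsFrom_mor₁ hT₂ (hR₂ B hB)) (cancelsFrom_mor₁_shift hT₂ (hR₂ B hB))
  · have hB' : B⟦(-1 : ℤ)⟧ ∈ shiftEnvelope A (Set.Iic (n - 1)) :=
      shift_shiftEnvelope (fun i hi => by simp only [Set.mem_Iic] at hi ⊢; lia) hB
    exact cancelsFrom_hom₃ hL hT φ
      (liftsFrom_mor₁ hT₁ (hR₁ _ hB')) (cancelsFrom_mor₁_shift hT₁ (hR₁ _ hB'))
      (cancelsFrom_mor₁ hT₂ (shift_rightPerp (by lia) hR₂ _ hB'))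

/-- Weight decompositions pass to retracts of objects that are bounded below. -/
lemma of_retract {N : C} (hN : ∀ n, HasWeightDecomposition A n N) {k : ℤ}
    (hk : N ∈ rightPerp A k) (j : ℕ) {M : C} (i : M ⟶ N) (r : N ⟶ M) (hir : i ≫ r = 𝟙 M) :
    HasWeightDecomposition A (k + j) M := by
  induction j generalizing M with
  | zero => exact of_mem_rightPerp (by simpa using retractClosed_rightPerp k hk i r hir)
  | succ j ih =>
    obtain ⟨K, s, d, hT⟩ := distinguished_cocone_triangle₁ r
    obtain ⟨t, hst⟩ := exists_retraction hT hir
    refine obj₃ hT ?_ (hN _)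
    have := ih s t hst
    rwa [Nat.cast_succ, ← add_assoc, add_sub_cancel_right]

end HasWeightDecomposition

section ThickClosure

variable {A : Set C}

lemma isThickClass_hasWeightDecomposition : IsThickClass C
    {M | (∃ k, M ∈ rightPerp A k) ∧ ∀ n, HasWeightDecomposition A n M} := by
  refine ⟨?_, ?_, ?_, ?_⟩
  · rintro M N ⟨⟨k, hk⟩, hN⟩ i r hir
    have hMk := retractClosed_rightPerp k hk i r hir
    refine ⟨⟨k, hMk⟩, fun n => ?_⟩
    obtain h | h := le_total n k
    · exact .of_mem_rightPerp (rightPerp_anti h hMk)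
    · obtain ⟨j, rfl⟩ := Int.le.dest h
      exact .of_retract hN hk j i r hir
  · intro Z hZ
    exact ⟨⟨0, (extClosed_rightPerp 0).1 Z hZ⟩,
      fun n => .of_mem_rightPerp ((extClosed_rightPerp n).1 Z hZ)⟩
  · rintro m M ⟨⟨k, hk⟩, hM⟩
    exact ⟨⟨k + m, shift_rightPerp rfl hk⟩, fun n => (hM (n - m)).shift (by lia)⟩
  · rintro Tr hTr ⟨⟨k, hk⟩, h₁⟩ ⟨⟨l, hl⟩, h₂⟩
    refine ⟨⟨min (k + 1) l, ?_⟩, fun n => .obj₃ hTr (h₁ _) (h₂ _)⟩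
    exact (extClosed_rightPerp _).2 _ (rot_of_distTriang _ hTr)
      (rightPerp_anti (min_le_right _ _) hl)
      (rightPerp_anti (min_le_left _ _) (shift_rightPerp rfl hk))

lemma IsNegative.hasWeightDecomposition (hA : IsNegative A) {M : C} (hM : M ∈ thickClosure C A)
    (n : ℤ) : HasWeightDecomposition A n M := by
  refine (hM _ isThickClass_hasWeightDecomposition fun X hX => ⟨⟨-1, ?_⟩, fun n => ?_⟩).2 n
  · exact shiftEnvelope_Ici_subset_rightPerp hA neg_one_lt_zero
      (subset_shiftEnvelope Set.self_mem_Ici hX)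
  · obtain h | h := lt_or_ge n 0
    · exact .of_mem_rightPerp (shiftEnvelope_Ici_subset_rightPerp hA h
        (subset_shiftEnvelope Set.self_mem_Ici hX))
    · exact .of_mem_shiftEnvelope (subset_shiftEnvelope h hX)

lemma exists_mem_shiftEnvelope_Iic {M : C} (hM : M ∈ thickClosure C A) :
    ∃ k : ℕ, M ∈ shiftEnvelope A (Set.Iic (k : ℤ)) := by
  have key : IsThickClass C {M | ∃ k : ℤ, M ∈ shiftEnvelope A (Set.Iic k)} := by
    refine ⟨?_, ?_, ?_, ?_⟩
    · rintro M N ⟨k, hk⟩ i r hir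
      exact ⟨k, retractClosed_envelope _ hk i r hir⟩
    · intro Z hZ
      exact ⟨0, (extClosed_envelope _).1 Z hZ⟩
    · rintro m M ⟨k, hk⟩
      exact ⟨k + m, shift_shiftEnvelope (fun i hi => by simp only [Set.mem_Iic] at hi ⊢; lia) hk⟩
    · rintro Tr hTr ⟨k, hk⟩ ⟨l, hl⟩
      refine ⟨max (k + 1) l, (extClosed_envelope _).2 _ (rot_of_distTriang _ hTr) ?_ ?_⟩
      · exact shiftEnvelope_mono (Set.Iic_subset_Iic.2 (le_max_right _ _)) hl
      · exact shift_shiftEnvelope (fun i hi => by simp only [Set.mem_Iic] at hi ⊢; lia) hk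
  obtain ⟨k, hk⟩ := hM _ key fun X hX => ⟨0, subset_shiftEnvelope Set.self_mem_Iic hX⟩
  exact ⟨k.toNat, shiftEnvelope_mono (Set.Iic_subset_Iic.2 k.self_le_toNat) hk⟩

end ThickClosure

section Heart

variable {A : Set C}

/-- Every object of the envelope of `A⟦i⟧`, `i ≤ 0`, has a map to an object of `A` that is
a weak reflection with respect to `rightPerp A (-1)`. -/
lemma exists_weak_reflection (hA : IsNegative A) (hzero : ∀ Z : C, IsZero Z → Z ∈ A)
    [HasBinaryBiproducts C] (hadd : ∀ X Y : C, X ∈ A → Y ∈ A → (X ⊞ Y) ∈ A) {M : C}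
    (hM : M ∈ shiftEnvelope A (Set.Iic 0)) :
    ∃ X ∈ A, ∃ u : M ⟶ X, ∀ Y ∈ rightPerp A (-1), ∀ f : M ⟶ Y, ∃ g : X ⟶ Y, u ≫ g = f := by
  let Q : Set C := {M | (∀ X ∈ A, HomZero M (X⟦(1 : ℤ)⟧)) ∧
    ∃ X ∈ A, ∃ u : M ⟶ X, ∀ Y ∈ rightPerp A (-1), ∀ f : M ⟶ Y, ∃ g : X ⟶ Y, u ≫ g = f}
  refine (hM Q ?_ ?_ ⟨?_, ?_⟩).2
  · rintro _ ⟨X, hX, i, hi : i ≤ 0, rfl⟩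
    refine ⟨fun Y hY => ?_, ?_⟩
    · exact homZero_shiftEnvelope hA (I := Set.Iic 0) (J := {1})
        (by rintro i (hi : i ≤ 0) _ rfl; lia)
        (shift_mem_shiftEnvelope hX hi) (shift_mem_shiftEnvelope hY rfl)
    · obtain hi | rfl := hi.lt_or_eq
      · refine ⟨_, hzero _ (isZero_zero C), 0, fun Y hY f => ⟨0, by
          rw [hY _ (shift_mem_shiftEnvelope hX (Set.mem_Iic.2 (by lia))) f, comp_zero]⟩⟩
      · exact ⟨X, hX, (shiftZero ℤ X).hom, fun Y _ f => ⟨(shiftZero ℤ X).inv ≫ f, by simp⟩⟩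
  · rintro M N ⟨hN, X, hX, u, hu⟩ i r hir
    refine ⟨fun Y hY f => ?_, X, hX, i ≫ u, fun Y hY f => ?_⟩
    · rw [← Category.id_comp f, ← hir, Category.assoc, hN Y hY (r ≫ f), comp_zero]
    · obtain ⟨g, hg⟩ := hu Y hY (r ≫ f)
      exact ⟨g, by rw [Category.assoc, hg, reassoc_of% hir]⟩
  · intro Z hZ
    exact ⟨fun _ _ _ => hZ.eq_of_src _ _, Z, hzero Z hZ, 𝟙 Z, fun _ _ f => ⟨f, by simp⟩⟩
  · rintro Tr hTr ⟨h₁, X₁, hX₁, u₁, hu₁⟩ ⟨h₃, X₃, hX₃, u₃, hu₃⟩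
    refine ⟨fun X hX => obj₂_homZero hTr (h₁ X hX) (h₃ X hX), X₁ ⊞ X₃, hadd _ _ hX₁ hX₃, ?_⟩
    obtain ⟨v, hv⟩ : ∃ v : Tr.obj₂ ⟶ X₁, u₁ = Tr.mor₁ ≫ v :=
      Triangle.yoneda_exact₂ _ (inv_rot_of_distTriang _ hTr) u₁
        ((((h₃ X₁ hX₁).shift (-1)).of_iso (Iso.refl _) (shiftShiftNeg X₁ (1 : ℤ)).symm) _)
    refine ⟨biprod.lift v (Tr.mor₂ ≫ u₃), fun Y hY f => ?_⟩
    obtain ⟨g₁, hg₁⟩ := hu₁ Y hY (Tr.mor₁ ≫ f)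
    obtain ⟨w, hw⟩ := Triangle.yoneda_exact₂ _ hTr (f - v ≫ g₁) (by
      rw [Preadditive.comp_sub, ← hg₁, hv, Category.assoc, sub_self])
    obtain ⟨g₃, rfl⟩ := hu₃ Y hY w
    exact ⟨biprod.desc g₁ g₃, by
      rw [biprod.lift_desc, Category.assoc, ← hw, add_sub_cancel]⟩

lemma mem_of_mem_shiftEnvelope_of_mem_rightPerp (hA : IsNegative A)
    (hzero : ∀ Z : C, IsZero Z → Z ∈ A)
    [HasBinaryBiproducts C] (hadd : ∀ X Y : C, X ∈ A → Y ∈ A → (X ⊞ Y) ∈ A)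
    (hkar : RetractClosed C A) {M : C} (hM : M ∈ shiftEnvelope A (Set.Iic 0))
    (hM' : M ∈ rightPerp A (-1)) : M ∈ A := by
  obtain ⟨X, hX, u, hu⟩ := exists_weak_reflection hA hzero hadd hM
  obtain ⟨r, hr⟩ := hu M hM' (𝟙 M)
  exact hkar hX u r hr

lemma mem_shiftEnvelope_Ici_of_mem_rightPerp (hA : IsNegative A) (hzero : ∀ Z : C, IsZero Z → Z ∈ A)
    [HasBinaryBiproducts C] (hadd : ∀ X Y : C, X ∈ A → Y ∈ A → (X ⊞ Y) ∈ A)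
    (hkar : RetractClosed C A) {M : C} (hM : M ∈ thickClosure C A)
    (hM' : M ∈ rightPerp A (-1)) : M ∈ shiftEnvelope A (Set.Ici 0) := by
  obtain ⟨k, hk⟩ := exists_mem_shiftEnvelope_Iic hM
  induction k generalizing M with
  | zero =>
    exact subset_shiftEnvelope Set.self_mem_Ici (mem_of_mem_shiftEnvelope_of_mem_rightPerp hA hzero hadd hkar
      hk hM')
  | succ k ih =>
    have hthick := isThickClass_thickClosure A
    obtain ⟨L, R, f, g, h, hT, hL, hR⟩ := hA.hasWeightDecomposition hM 0
    have hL' : L ∈ A := mem_of_mem_shiftEnvelope_of_mem_rightPerp hA hzero hadd hkar hL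
      ((extClosed_rightPerp _).2 _ (inv_rot_of_distTriang _ hT)
        (shift_rightPerp (by lia) hR) hM')
    have hRT : R ∈ thickClosure C A :=
      hthick.2.2.2 _ hT (shiftEnvelope_subset_thickClosure hL) hM
    have hRk : R ∈ shiftEnvelope A (Set.Iic ((k + 1 : ℕ) : ℤ)) :=
      (extClosed_envelope _).2 _ (rot_of_distTriang _ hT) hk
        (shift_shiftEnvelope (fun i hi => by simp only [Set.mem_Iic] at hi ⊢; lia) hL)
    have hR' : R⟦(-1 : ℤ)⟧ ∈ shiftEnvelope A (Set.Ici 0) :=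
      ih (hthick.2.2.1 _ hRT) (shift_rightPerp (by lia) hR)
        (shift_shiftEnvelope (fun i hi => by simp only [Set.mem_Iic] at hi ⊢; lia) hRk)
    refine (extClosed_envelope _).2 _ hT (subset_shiftEnvelope Set.self_mem_Ici hL') ?_
    exact (retractClosed_envelope _).of_iso
      (shift_shiftEnvelope (fun i hi => by simp only [Set.mem_Ici] at hi ⊢; lia) hR')
      (shiftNegShift R (1 : ℤ)).symm

lemma isWeightStructureOn_shiftEnvelope (hA : IsNegative A) (hzero : ∀ Z : C, IsZero Z → Z ∈ A)
    [HasBinaryBiproducts C] (hadd : ∀ X Y : C, X ∈ A → Y ∈ A → (X ⊞ Y) ∈ A)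
    (hkar : RetractClosed C A) :
    IsWeightStructureOn C (thickClosure C A) (shiftEnvelope A (Set.Iic 0))
      (shiftEnvelope A (Set.Ici 0)) := by
  refine ⟨shiftEnvelope_subset_thickClosure, shiftEnvelope_subset_thickClosure,
    fun _ _ _ hY => retractClosed_envelope _ hY, fun _ _ _ hY => retractClosed_envelope _ hY,
    fun _ hX => shift_shiftEnvelope (fun i hi => by simp only [Set.mem_Iic] at hi ⊢; lia) hX,
    fun _ hX => shift_shiftEnvelope (fun i hi => by simp only [Set.mem_Ici] at hi ⊢; lia) hX,
    fun X Y hX hY => homZero_shiftEnvelope hA (J := Set.Ici 1)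
      (fun i hi j hj => by simp only [Set.mem_Iic, Set.mem_Ici] at hi hj; lia) hX
      (shift_shiftEnvelope (fun i hi => by simp only [Set.mem_Ici] at hi ⊢; lia) hY),
    fun M hM => ?_⟩
  obtain ⟨L, R, f, g, h, hT, hL, hR⟩ := hA.hasWeightDecomposition hM 0
  have hthick := isThickClass_thickClosure A
  refine ⟨L, R, f, g, h, hT, hL, ?_⟩
  refine mem_shiftEnvelope_Ici_of_mem_rightPerp hA hzero hadd hkar (hthick.2.2.1 _ ?_)
    (shift_rightPerp (by lia) hR)
  exact hthick.2.2.2 _ hT (shiftEnvelope_subset_thickClosure hL) hM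

lemma shiftEnvelope_Iic_inter_Ici (hA : IsNegative A) (hzero : ∀ Z : C, IsZero Z → Z ∈ A)
    [HasBinaryBiproducts C] (hadd : ∀ X Y : C, X ∈ A → Y ∈ A → (X ⊞ Y) ∈ A)
    (hkar : RetractClosed C A) :
    shiftEnvelope A (Set.Iic 0) ∩ shiftEnvelope A (Set.Ici 0) = A := by
  refine Set.Subset.antisymm (fun M hM => ?_) (Set.subset_inter
    (subset_shiftEnvelope Set.self_mem_Iic) (subset_shiftEnvelope Set.self_mem_Ici))
  exact mem_of_mem_shiftEnvelope_of_mem_rightPerp hA hzero hadd hkar hM.1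
    (shiftEnvelope_Ici_subset_rightPerp hA neg_one_lt_zero hM.2)

end Heart

namespace IsWeightStructureOn

variable {T le ge : Set C}

lemma mem_le_iff (hw : IsWeightStructureOn C T le ge) {M : C} (hM : M ∈ T) :
    M ∈ le ↔ ∀ N ∈ ge, HomZero M (N⟦(1 : ℤ)⟧) := by
  obtain ⟨-, -, hle, -, -, -, horth, hdec⟩ := hw
  refine ⟨fun h N hN => horth h hN, fun h => ?_⟩
  obtain ⟨L, R, f, g, d, hT, hL, hR⟩ := hdec M hM
  have hMR : HomZero M R := (h _ hR).of_iso (Iso.refl M) (shiftNegShift R (1 : ℤ)).symm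
  obtain ⟨s, hs⟩ := liftsFrom_mor₁ hT hMR (𝟙 M)
  exact hle hM hL s f hs

lemma mem_ge_iff (hw : IsWeightStructureOn C T le ge) (hT : IsThickClass C T) {M : C}
    (hM : M ∈ T) : M ∈ ge ↔ ∀ N ∈ le, HomZero N (M⟦(1 : ℤ)⟧) := by
  obtain ⟨-, -, -, hge, -, -, horth, hdec⟩ := hw
  refine ⟨fun h N hN => horth hN h, fun h => ?_⟩
  obtain ⟨L, R, f, g, d, hTr, hL, hR⟩ := hdec _ (hT.2.2.1 1 hM)
  obtain ⟨r, hr⟩ : ∃ r : R ⟶ M⟦(1 : ℤ)⟧, 𝟙 _ = g ≫ r :=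
    Triangle.yoneda_exact₂ _ hTr (𝟙 _) (h L hL _)
  refine hge hM hR ((shiftShiftNeg M (1 : ℤ)).inv ≫ g⟦(-1 : ℤ)⟧')
    (r⟦(-1 : ℤ)⟧' ≫ (shiftShiftNeg M (1 : ℤ)).hom) ?_
  rw [Category.assoc, ← Functor.map_comp_assoc, ← hr, CategoryTheory.Functor.map_id, Category.id_comp,
    Iso.inv_hom_id]

lemma extClosed_le (hw : IsWeightStructureOn C T le ge) (hT : IsThickClass C T) :
    ExtClosed C le := by
  have hle := hw.1
  refine ⟨fun Z hZ => (hw.mem_le_iff (hT.2.1 Z hZ)).2 fun _ _ _ => hZ.eq_of_src _ _, ?_⟩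
  intro Tr hTr h₁ h₃
  refine (hw.mem_le_iff (hT.extClosed.2 Tr hTr (hle h₁) (hle h₃))).2 fun N hN => ?_
  exact obj₂_homZero hTr ((hw.mem_le_iff (hle h₁)).1 h₁ N hN)
    ((hw.mem_le_iff (hle h₃)).1 h₃ N hN)

lemma extClosed_ge (hw : IsWeightStructureOn C T le ge) (hT : IsThickClass C T) :
    ExtClosed C ge := by
  have hge := hw.2.1
  refine ⟨fun Z hZ => (hw.mem_ge_iff hT (hT.2.1 Z hZ)).2
    fun _ _ _ => (Functor.map_isZero _ hZ).eq_of_tgt _ _, ?_⟩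
  intro Tr hTr h₁ h₃
  refine (hw.mem_ge_iff hT (hT.extClosed.2 Tr hTr (hge h₁) (hge h₃))).2 fun N hN => ?_
  exact homZero_obj₂ (Triangle.shift_distinguished _ hTr 1)
    ((hw.mem_ge_iff hT (hge h₁)).1 h₁ N hN) ((hw.mem_ge_iff hT (hge h₃)).1 h₃ N hN)

lemma retractClosed_le (hw : IsWeightStructureOn C T le ge) (hT : IsThickClass C T) :
    RetractClosed C le :=
  fun _ _ hY i r hir => hw.2.2.1 (hT.1 (hw.1 hY) i r hir) hY i r hir

lemma retractClosed_ge (hw : IsWeightStructureOn C T le ge) (hT : IsThickClass C T) :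
    RetractClosed C ge :=
  fun _ _ hY i r hir => hw.2.2.2.1 (hT.1 (hw.2.1 hY) i r hir) hY i r hir

lemma shiftEnvelope_Iic_subset (hw : IsWeightStructureOn C T le ge) (hT : IsThickClass C T)
    {A : Set C} (hA : A ⊆ le) : shiftEnvelope A (Set.Iic 0) ⊆ le := by
  have key : ∀ (n : ℕ) (X : C), X ∈ A → X⟦-(n : ℤ)⟧ ∈ le := by
    intro n X hX
    induction n with
    | zero =>
      exact (hw.retractClosed_le hT).of_iso (hA hX)
        ((shiftFunctorZero' C (-((0 : ℕ) : ℤ)) (by simp)).app X)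
    | succ n ih =>
      exact (hw.retractClosed_le hT).of_iso (hw.2.2.2.2.1 ih)
        ((shiftFunctorAdd' C (-(n : ℤ)) (-1) (-((n + 1 : ℕ) : ℤ)) (by lia)).app X)
  refine fun M hM => hM le ?_ (hw.retractClosed_le hT) (hw.extClosed_le hT)
  rintro _ ⟨X, hX, i, hi : i ≤ 0, rfl⟩
  obtain ⟨n, rfl⟩ : ∃ n : ℕ, i = -n := ⟨i.natAbs, by lia⟩
  exact key n X hX

lemma shiftEnvelope_Ici_subset (hw : IsWeightStructureOn C T le ge) (hT : IsThickClass C T)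
    {A : Set C} (hA : A ⊆ ge) : shiftEnvelope A (Set.Ici 0) ⊆ ge := by
  have key : ∀ (n : ℕ) (X : C), X ∈ A → X⟦(n : ℤ)⟧ ∈ ge := by
    intro n X hX
    induction n with
    | zero =>
      exact (hw.retractClosed_ge hT).of_iso (hA hX)
        ((shiftFunctorZero' C ((0 : ℕ) : ℤ) (by simp)).app X)
    | succ n ih =>
      exact (hw.retractClosed_ge hT).of_iso (hw.2.2.2.2.2.1 ih)
        ((shiftFunctorAdd' C (n : ℤ) 1 ((n + 1 : ℕ) : ℤ) (by lia)).app X)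
  refine fun M hM => hM ge ?_ (hw.retractClosed_ge hT) (hw.extClosed_ge hT)
  rintro _ ⟨X, hX, i, hi : 0 ≤ i, rfl⟩
  obtain ⟨n, rfl⟩ := Int.eq_ofNat_of_zero_le hi
  exact key n X hX

/-- Comparable weight structures on the same thick subcategory are equal. -/
lemma eq_of_subset (hw : IsWeightStructureOn C T le ge) (hT : IsThickClass C T) {le' ge' : Set C}
    (hw' : IsWeightStructureOn C T le' ge') (hle : le ⊆ le')
    (hge : ge ⊆ ge') : le' = le ∧ ge' = ge := by
  refine ⟨Set.Subset.antisymm (fun M hM => ?_) hle, Set.Subset.antisymm (fun M hM => ?_) hge⟩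
  · exact (hw.mem_le_iff (hw'.1 hM)).2 fun N hN =>
      (hw'.mem_le_iff (hw'.1 hM)).1 hM N (hge hN)
  · exact (hw.mem_ge_iff hT (hw'.2.1 hM)).2 fun N hN =>
      (hw'.mem_ge_iff hT (hw'.2.1 hM)).1 hM N (hle hN)

end IsWeightStructureOn

end Auxiliary

/-- A negative Karoubian additive subcategory `A` of a triangulated category `C`
generates a weight structure on the thick subcategory `⟨A⟩` it generates: there is a
unique weight structure on `⟨A⟩` whose heart contains `A`; its nonpositive part is the
envelope of `⋃_{i≤0} A[i]`, its nonnegative part is the envelope of `⋃_{i≥0} A[i]`,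
and its heart equals `A`. -/
theorem negative_subcategory_generates_weight_structure [HasBinaryBiproducts C]
    (A : Set C)
    -- `A` is additive:
    (hzero : ∀ Z : C, IsZero Z → Z ∈ A)
    (hadd : ∀ X Y : C, X ∈ A → Y ∈ A → (X ⊞ Y) ∈ A)
    -- `A` is Karoubian (Karoubi-closed in `C`):
    (hkar : RetractClosed C A)
    -- `A` is negative: `Hom(A, B[i]) = 0` for `A, B ∈ A`, `i > 0`:
    (hneg : ∀ ⦃X Y : C⦄, X ∈ A → Y ∈ A → ∀ i : ℤ, 0 < i → ∀ f : X ⟶ Y⟦i⟧, f = 0) :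
    ∃ le ge : Set C,
      IsWeightStructureOn C (thickClosure C A) le ge ∧
      le = envelope C {Y : C | ∃ X ∈ A, ∃ i : ℤ, i ≤ 0 ∧ Y = X⟦i⟧} ∧
      ge = envelope C {Y : C | ∃ X ∈ A, ∃ i : ℤ, 0 ≤ i ∧ Y = X⟦i⟧} ∧
      le ∩ ge = A ∧
      (∀ le' ge' : Set C, IsWeightStructureOn C (thickClosure C A) le' ge' →
        A ⊆ le' ∩ ge' → le' = le ∧ ge' = ge) := by
  have hthick := isThickClass_thickClosure A
  have hw := isWeightStructureOn_shiftEnvelope hneg hzero hadd hkar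
  refine ⟨shiftEnvelope A (Set.Iic 0), shiftEnvelope A (Set.Ici 0), hw, rfl, rfl,
    shiftEnvelope_Iic_inter_Ici hneg hzero hadd hkar, fun le' ge' hw' hA => ?_⟩
  exact hw.eq_of_subset hthick hw'
    (hw'.shiftEnvelope_Iic_subset hthick fun _ hX => (hA hX).1)
    (hw'.shiftEnvelope_Ici_subset hthick fun _ hX => (hA hX).2)
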